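/- arXiv:2103.07407 — 8 statements merged into one kernel-verified Lean document; each statement's English description precedes it below -/
import Mathlib

section
/- Let a, β ∈ ℝ with |a| < |β|, and let f : [0,∞) → ℝ be measurable and locally bounded. Then the function Ψ defined by Ψ(t) = f(t) + ∫_0^t f(s) · a · e^{(a−β)(t−s)} ds satisfies, for every t ≥ 0, the Volterra equation of the second kind Ψ(t) = f(t) + ∫_0^t Ψ(t−s) · a e^{−β s} ds. -/
open MeasureTheory

theorem IntervalIntegrable.of_abs_le_on_Icc {f : ℝ → ℝ} (hf : Measurable f) {a b C : ℝ}
    (hab : a ≤ b) (hC : ∀ x ∈ Set.Icc a b, |f x| ≤ C) : IntervalIntegrable f volume a b := by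
  rw [intervalIntegrable_iff_integrableOn_Icc_of_le hab]
  refine IntegrableOn.of_bound measure_Icc_lt_top hf.aestronglyMeasurable C ?_
  filter_upwards [ae_restrict_mem measurableSet_Icc] with x hx
  exact hC x hx

/-- The product rule for `exp (a * u) * ∫ s in c..u, h s`, integrated over `c..t`. -/
theorem IntervalIntegrable.integral_exp_mul_primitive {h : ℝ → ℝ} {c t : ℝ}
    (hh : IntervalIntegrable h volume c t) (a : ℝ) :
    ∫ u in c..t, (a * Real.exp (a * u) * (∫ s in c..u, h s) + Real.exp (a * u) * h u)
      = Real.exp (a * t) * ∫ s in c..t, h s := by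
  have hexp : AbsolutelyContinuousOnInterval (fun u => Real.exp (a * u)) c t :=
    ContDiffOn.absolutelyContinuousOnInterval (by fun_prop)
  have hprim : AbsolutelyContinuousOnInterval (fun u => ∫ s in c..u, h s) c t :=
    hh.absolutelyContinuousOnInterval_intervalIntegral Set.left_mem_uIcc
  have key := hexp.integral_deriv_mul_eq_sub hprim
  simp only [intervalIntegral.integral_same, mul_zero, sub_zero] at key
  rw [← key]
  apply intervalIntegral.integral_congr_ae
  filter_upwards [hh.ae_hasDerivAt_integral] with u hu hmem
  have hd : HasDerivAt (fun u => Real.exp (a * u)) (Real.exp (a * u) * (a * 1)) u :=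
    ((hasDerivAt_id u).const_mul a).exp
  rw [(hu (Set.uIoc_subset_uIcc hmem) c Set.left_mem_uIcc).deriv, hd.deriv]
  ring

/-- The function Ψ(t) = f(t) + ∫_0^t f(s)·a·e^{(a−β)(t−s)} ds solves the
Volterra equation Ψ(t) = f(t) + ∫_0^t Ψ(t−s)·a e^{−β s} ds for all t ≥ 0. -/
theorem volterra_solution
    (a β : ℝ) (hab : |a| < |β|)
    (f : ℝ → ℝ) (hf_meas : Measurable f)
    (hf_loc : ∀ K : ℝ, 0 ≤ K → ∃ C : ℝ, ∀ t ∈ Set.Icc (0:ℝ) K, |f t| ≤ C)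
    (Ψ : ℝ → ℝ)
    (hΨ : ∀ t : ℝ, Ψ t = f t + ∫ s in (0:ℝ)..t, f s * (a * Real.exp ((a - β) * (t - s)))) :
    ∀ t : ℝ, 0 ≤ t →
      Ψ t = f t + ∫ s in (0:ℝ)..t, Ψ (t - s) * (a * Real.exp (-β * s)) := by
  intro t ht
  obtain ⟨C, hC⟩ := hf_loc t ht
  set h : ℝ → ℝ := fun s => f s * Real.exp (-(a - β) * s) with hh
  have hint : IntervalIntegrable h volume 0 t :=
    (IntervalIntegrable.of_abs_le_on_Icc hf_meas ht hC).mul_continuousOn (by fun_prop)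
  have hΨ' (u : ℝ) : Ψ u = f u + a * Real.exp ((a - β) * u) * ∫ s in (0:ℝ)..u, h s := by
    rw [hΨ u, ← intervalIntegral.integral_const_mul]
    congr 2 with s
    rw [hh, show (a - β) * (u - s) = (a - β) * u + -(a - β) * s by ring, Real.exp_add]
    ring
  have hreflect := intervalIntegral.integral_comp_sub_left (a := 0) (b := t)
    (fun u => Ψ u * (a * Real.exp (-β * (t - u)))) t
  simp only [sub_sub_cancel, sub_self, sub_zero] at hreflect
  have hintegrand (u : ℝ) : Ψ u * (a * Real.exp (-β * (t - u))) = a * Real.exp (-β * t) *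
      (a * Real.exp (a * u) * (∫ s in (0:ℝ)..u, h s) + Real.exp (a * u) * h u) := by
    have h₁ : Real.exp (-β * (t - u)) = Real.exp (-β * t) * Real.exp (β * u) := by
      rw [← Real.exp_add]; ring_nf
    have h₂ : Real.exp (a * u) = Real.exp ((a - β) * u) * Real.exp (β * u) := by
      rw [← Real.exp_add]; ring_nf
    have h₃ : Real.exp (a * u) * h u = f u * Real.exp (β * u) := by
      rw [hh, mul_left_comm, ← Real.exp_add]; ring_nf
    rw [h₃, hΨ', h₁, h₂]
    ring
  rw [hreflect]
  simp_rw [hintegrand]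
  rw [intervalIntegral.integral_const_mul, hint.integral_exp_mul_primitive, hΨ',
    show (a - β) * t = -β * t + a * t by ring, Real.exp_add]
  ring
end

section
/- Let α, β > 0 and m > 0 with α·m < β. Define g, h : [0,∞) → ℝ by g(t) = βm/(2(β−αm)) + βm/(2(β+αm)) − (αm²/(2(β−αm))) e^{−(β−αm)t} + (αm²/(2(β+αm))) e^{−(β+αm)t} and h(t) = βm/(2(β−αm)) − βm/(2(β+αm)) − (αm²/(2(β−αm))) e^{−(β−αm)t} − (αm²/(2(β+αm))) e^{−(β+αm)t}. Then for all t ≥ 0: g(t) = m + αm ∫_0^t h(t−s) e^{−β s} ds and h(t) = αm ∫_0^t g(t−s) e^{−β s} ds. -/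
open MeasureTheory

/-- Convolution of a constant plus exponentials of rates `b - c` and `b + c` with `exp (-b s)`. -/
theorem integral_const_add_exp_mul_exp (b c K P Q t : ℝ) (hb : b ≠ 0) (hc : c ≠ 0) :
    ∫ s in (0:ℝ)..t, (K + P * Real.exp (-(b - c) * (t - s)) + Q * Real.exp (-(b + c) * (t - s)))
        * Real.exp (-b * s) =
      K / b * (1 - Real.exp (-b * t)) + P / c * (Real.exp (-(b - c) * t) - Real.exp (-b * t))
        + Q / c * (Real.exp (-b * t) - Real.exp (-(b + c) * t)) := by
  have hexp : ∀ a s : ℝ,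
      HasDerivAt (fun s => Real.exp (a * (t - s))) (Real.exp (a * (t - s)) * (a * -1)) s :=
    fun a s => (((hasDerivAt_id s).const_sub t).const_mul a).exp
  have hexpb : ∀ s : ℝ,
      HasDerivAt (fun s => Real.exp (-b * s)) (Real.exp (-b * s) * (-b * 1)) s :=
    fun s => ((hasDerivAt_id s).const_mul (-b)).exp
  have key := intervalIntegral.integral_eq_sub_of_hasDerivAt (a := 0) (b := t)
    (f := fun s => (-K / b + -P / c * Real.exp (-(b - c) * (t - s))
      + Q / c * Real.exp (-(b + c) * (t - s))) * Real.exp (-b * s))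
    (f' := fun s => (K + P * Real.exp (-(b - c) * (t - s)) + Q * Real.exp (-(b + c) * (t - s)))
      * Real.exp (-b * s))
    (fun s _ => by
      refine (((((hexp (-(b - c)) s).const_mul (-P / c)).const_add (-K / b)).add
        ((hexp (-(b + c)) s).const_mul (Q / c))).mul (hexpb s)).congr_deriv ?_
      simp only [Pi.add_apply]
      field_simp
      ring)
    (Continuous.intervalIntegrable (by fun_prop) _ _)
  rw [key]
  simp only [sub_self, mul_zero, Real.exp_zero, sub_zero]
  ring

/-- The coupled Volterra system satisfied by the closed forms g and h. -/
theorem coupled_volterra_system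
    (α β m : ℝ) (hα : 0 < α) (hβ : 0 < β) (hm : 0 < m) (hstab : α * m < β) :
    let g : ℝ → ℝ := fun t =>
      β * m / (2 * (β - α * m)) + β * m / (2 * (β + α * m))
        - (α * m ^ 2 / (2 * (β - α * m))) * Real.exp (-(β - α * m) * t)
        + (α * m ^ 2 / (2 * (β + α * m))) * Real.exp (-(β + α * m) * t)
    let h : ℝ → ℝ := fun t =>
      β * m / (2 * (β - α * m)) - β * m / (2 * (β + α * m))
        - (α * m ^ 2 / (2 * (β - α * m))) * Real.exp (-(β - α * m) * t)
        - (α * m ^ 2 / (2 * (β + α * m))) * Real.exp (-(β + α * m) * t)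
    ∀ t : ℝ, 0 ≤ t →
      (g t = m + α * m * ∫ s in (0:ℝ)..t, h (t - s) * Real.exp (-β * s)) ∧
      (h t = α * m * ∫ s in (0:ℝ)..t, g (t - s) * Real.exp (-β * s)) := by
  intro g h t _
  have hminus : β - m * α ≠ 0 := (by linarith : 0 < β - m * α).ne'
  have hplus : β + α * m ≠ 0 := by positivity
  have hc : α * m ≠ 0 := by positivity
  have hg := integral_const_add_exp_mul_exp β (α * m)
    (β * m / (2 * (β - α * m)) + β * m / (2 * (β + α * m)))
    (-(α * m ^ 2 / (2 * (β - α * m)))) (α * m ^ 2 / (2 * (β + α * m))) t hβ.ne' hc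
  have hh := integral_const_add_exp_mul_exp β (α * m)
    (β * m / (2 * (β - α * m)) - β * m / (2 * (β + α * m)))
    (-(α * m ^ 2 / (2 * (β - α * m)))) (-(α * m ^ 2 / (2 * (β + α * m)))) t hβ.ne' hc
  simp only [neg_mul _ (Real.exp _), ← sub_eq_add_neg] at hg hh
  simp only [g, h]
  rw [hg, hh]
  generalize Real.exp (-(β - α * m) * t) = x
  generalize Real.exp (-(β + α * m) * t) = y
  generalize Real.exp (-β * t) = z
  constructor
  · field_simp
    ring
  · field_simp
    ring
end

section
/- Let α, β > 0 and m > 0 with α·m < β. The function Ψ(t) = βm/(β−αm) − (αm²/(β−αm)) e^{−(β−αm)t} satisfies, for all t ≥ 0, the equation Ψ(t) = m + αm ∫_0^t Ψ(t−s) e^{−β s} ds. -/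
open MeasureTheory

/-- The closed form Ψ solves the scalar Volterra equation
Ψ(t) = m + αm ∫_0^t Ψ(t−s) e^{−β s} ds. -/
theorem scalar_volterra_closed_form
    (α β m : ℝ) (hα : 0 < α) (hβ : 0 < β) (hm : 0 < m) (hstab : α * m < β) :
    let Ψ : ℝ → ℝ := fun t =>
      β * m / (β - α * m) - (α * m ^ 2 / (β - α * m)) * Real.exp (-(β - α * m) * t)
    ∀ t : ℝ, 0 ≤ t →
      Ψ t = m + α * m * ∫ s in (0:ℝ)..t, Ψ (t - s) * Real.exp (-β * s) := by
  intro Ψ t _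
  have hk : β - α * m ≠ 0 := by linarith
  have hderiv (s : ℝ) : HasDerivAt
      (fun s => m / (β - α * m) * ((Real.exp (-(β - α * m) * (t - s)) - 1) * Real.exp (-β * s)))
      (Ψ (t - s) * Real.exp (-β * s)) s := by
    have h₁ := ((((hasDerivAt_id s).const_sub t).const_mul (-(β - α * m))).exp).sub_const 1
    have h₂ := ((hasDerivAt_id s).const_mul (-β)).exp
    refine ((h₁.mul h₂).const_mul (m / (β - α * m))).congr_deriv ?_
    simp only [Ψ, id]
    generalize Real.exp (-(β - α * m) * (t - s)) = E
    field_simp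
    ring
  have hcont : Continuous fun s => Ψ (t - s) * Real.exp (-β * s) := by
    simp only [Ψ]
    fun_prop
  rw [intervalIntegral.integral_eq_sub_of_hasDerivAt (fun s _ => hderiv s)
    (hcont.intervalIntegrable 0 t)]
  simp only [Ψ, sub_self, sub_zero, mul_zero, Real.exp_zero, zero_mul, mul_one]
  linear_combination m * mul_inv_cancel₀ hk
end

section
/- Let α, β, μ₀, κ, T > 0 and m > 0 with α·m < β. The function L(t) = μ₀ [ ((β + κ/T)/(β − αm + κ/T)) e^{κ t/T} − (αm/(β − αm + κ/T)) e^{−(β−αm)t} ] satisfies, for all t ∈ [0,T], the renewal equation L(t) = μ₀ e^{κ t/T} + αm ∫_0^t e^{−β(t−s)} L(s) ds. -/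
open MeasureTheory

/-- The closed form L of the expected intensity satisfies the renewal
equation L(t) = μ₀ e^{κ t/T} + αm ∫_0^t e^{−β(t−s)} L(s) ds on [0,T]. -/
theorem expected_intensity_renewal_equation
    (α β μ₀ κ T m : ℝ) (hα : 0 < α) (hβ : 0 < β) (hμ₀ : 0 < μ₀) (hκ : 0 < κ)
    (hT : 0 < T) (hm : 0 < m) (hstab : α * m < β) :
    let L : ℝ → ℝ := fun t =>
      μ₀ * ((β + κ / T) / (β - α * m + κ / T) * Real.exp (κ * t / T)
        - α * m / (β - α * m + κ / T) * Real.exp (-(β - α * m) * t))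
    ∀ t : ℝ, t ∈ Set.Icc (0:ℝ) T →
      L t = μ₀ * Real.exp (κ * t / T)
        + α * m * ∫ s in (0:ℝ)..t, Real.exp (-β * (t - s)) * L s := by
  intro L t _
  have hD : β - α * m + κ / T ≠ 0 := by
    have : 0 < κ / T := div_pos hκ hT
    linarith
  have hderiv : ∀ s ∈ Set.uIcc (0:ℝ) t, HasDerivAt
      (fun s => Real.exp (-β * (t - s)) * (μ₀ / (β - α * m + κ / T) *
        (Real.exp (κ * s / T) - Real.exp (-(β - α * m) * s))))
      (Real.exp (-β * (t - s)) * L s) s := by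
    intro s _
    have h₁ : HasDerivAt (fun s => -β * (t - s)) β s := by
      simpa using ((hasDerivAt_id s).const_sub t).const_mul (-β)
    have h₂ : HasDerivAt (fun s => κ * s / T) (κ / T) s := by
      simpa using ((hasDerivAt_id s).const_mul κ).div_const T
    have h₃ : HasDerivAt (fun s => -(β - α * m) * s) (-(β - α * m)) s := by
      simpa using (hasDerivAt_id s).const_mul (-(β - α * m))
    refine (h₁.exp.mul ((h₂.exp.sub h₃.exp).const_mul (μ₀ / (β - α * m + κ / T)))).congr_deriv ?_
    simp only [L, Pi.sub_apply]
    ring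
  have hcont : Continuous fun s => Real.exp (-β * (t - s)) * L s := by
    simp only [L]
    fun_prop
  rw [intervalIntegral.integral_eq_sub_of_hasDerivAt hderiv (hcont.intervalIntegrable 0 t)]
  simp only [L, sub_self, mul_zero, zero_div, Real.exp_zero, one_mul, sub_zero]
  generalize κ / T = k at hD ⊢
  field_simp
  ring
end

section
/- Let α, β > 0, m > 0 with α·m < β, and m₂ > 0. Set Φ̃(t) = m₂ ( β/(β+αm) + (αm/(β+αm)) e^{−(β+αm)t} )², and define Ψ₂(t) = m₂ ( C̃₁ e^{−(β−αm)t} + C̃₂ e^{−2(β+αm)t} + C̃₃ e^{−(β+αm)t} + C̃₄ ) with C̃₁ = −α²m²/((β−αm)(β+3αm)), C̃₂ = α²m²(β+2αm)/((β+αm)²(β+3αm)), C̃₃ = αβm/(β+αm)², C̃₄ = β³/((β+αm)²(β−αm)). Then for all t ≥ 0, Ψ₂(t) = Φ̃(t) + αm ∫_0^t Ψ₂(s) e^{−β(t−s)} ds. -/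
open MeasureTheory

theorem integral_exp_mul_mul_exp_neg_mul_sub (k b t : ℝ) (h : k + b ≠ 0) :
    ∫ s in (0:ℝ)..t, Real.exp (k * s) * Real.exp (-b * (t - s))
      = (Real.exp (k * t) - Real.exp (-b * t)) / (k + b) := by
  have hd : ∀ s ∈ Set.uIcc 0 t,
      HasDerivAt (fun s => Real.exp (k * s + -b * (t - s)) / (k + b))
        (Real.exp (k * s) * Real.exp (-b * (t - s))) s := by
    intro s _
    have h₁ : HasDerivAt (fun s : ℝ => k * s + -b * (t - s)) (k + b) s := by
      refine (((hasDerivAt_id s).const_mul k).add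
        (((hasDerivAt_id s).const_sub t).const_mul (-b))).congr_deriv ?_
      ring
    refine (h₁.exp.div_const (k + b)).congr_deriv ?_
    rw [← Real.exp_add, mul_div_cancel_right₀ _ h]
  rw [intervalIntegral.integral_eq_sub_of_hasDerivAt hd
    (Continuous.intervalIntegrable (by fun_prop) _ _)]
  simp [sub_div]

/-- The closed form Ψ₂ solves the Volterra equation
Ψ₂(t) = Φ̃(t) + αm ∫_0^t Ψ₂(s) e^{−β(t−s)} ds. -/
theorem second_moment_volterra
    (α β m m₂ : ℝ) (hα : 0 < α) (hβ : 0 < β) (hm : 0 < m) (hstab : α * m < β)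
    (hm₂ : 0 < m₂) :
    let Φ : ℝ → ℝ := fun t =>
      m₂ * (β / (β + α * m) + (α * m / (β + α * m)) * Real.exp (-(β + α * m) * t)) ^ 2
    let C₁ : ℝ := -(α ^ 2 * m ^ 2) / ((β - α * m) * (β + 3 * α * m))
    let C₂ : ℝ := α ^ 2 * m ^ 2 * (β + 2 * α * m)
      / ((β + α * m) ^ 2 * (β + 3 * α * m))
    let C₃ : ℝ := α * β * m / (β + α * m) ^ 2
    let C₄ : ℝ := β ^ 3 / ((β + α * m) ^ 2 * (β - α * m))
    let Ψ₂ : ℝ → ℝ := fun t =>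
      m₂ * (C₁ * Real.exp (-(β - α * m) * t) + C₂ * Real.exp (-2 * (β + α * m) * t)
        + C₃ * Real.exp (-(β + α * m) * t) + C₄)
    ∀ t : ℝ, 0 ≤ t →
      Ψ₂ t = Φ t + α * m * ∫ s in (0:ℝ)..t, Ψ₂ s * Real.exp (-β * (t - s)) := by
  intro Φ C₁ C₂ C₃ C₄ Ψ₂ t _
  obtain ⟨a, ha⟩ : ∃ a, a = α * m := ⟨_, rfl⟩
  have ha₀ : 0 < a := ha ▸ mul_pos hα hm
  have hba : 0 < β - a := by linarith
  have hint : ∫ s in (0:ℝ)..t, Ψ₂ s * Real.exp (-β * (t - s))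
      = m₂ * (C₁ * ((Real.exp (-(β - a) * t) - Real.exp (-β * t)) / (-(β - a) + β))
        + C₂ * ((Real.exp (-2 * (β + a) * t) - Real.exp (-β * t)) / (-2 * (β + a) + β))
        + C₃ * ((Real.exp (-(β + a) * t) - Real.exp (-β * t)) / (-(β + a) + β))
        + C₄ * ((Real.exp (0 * t) - Real.exp (-β * t)) / (0 + β))) := by
    rw [← integral_exp_mul_mul_exp_neg_mul_sub (-(β - a)) β t (by linarith),
      ← integral_exp_mul_mul_exp_neg_mul_sub (-2 * (β + a)) β t (by linarith),
      ← integral_exp_mul_mul_exp_neg_mul_sub (-(β + a)) β t (by linarith),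
      ← integral_exp_mul_mul_exp_neg_mul_sub 0 β t (by linarith)]
    simp only [← intervalIntegral.integral_const_mul]
    rw [← intervalIntegral.integral_add, ← intervalIntegral.integral_add,
      ← intervalIntegral.integral_add, ← intervalIntegral.integral_const_mul]
    · congr 1
      ext s
      simp only [Ψ₂, ← ha, zero_mul, Real.exp_zero]
      ring
    all_goals exact Continuous.intervalIntegrable (by fun_prop) _ _
  have hsq : Real.exp (-2 * (β + a) * t) = Real.exp (-(β + a) * t) ^ 2 := by
    rw [← Real.exp_nat_mul]
    congr 1
    push_cast
    ring
  have hC₁ : C₁ = -a ^ 2 / ((β - a) * (β + 3 * a)) := by simp only [C₁, ha]; ring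
  have hC₂ : C₂ = a ^ 2 * (β + 2 * a) / ((β + a) ^ 2 * (β + 3 * a)) := by
    simp only [C₂, ha]; ring
  have hC₃ : C₃ = a * β / (β + a) ^ 2 := by simp only [C₃, ha]; ring
  have hC₄ : C₄ = β ^ 3 / ((β + a) ^ 2 * (β - a)) := by simp only [C₄, ha]
  rw [hint]
  simp only [Ψ₂, Φ, ← ha]
  rw [hsq, hC₁, hC₂, hC₃, hC₄, zero_mul, Real.exp_zero,
    show -(β - a) + β = a by ring, show -2 * (β + a) + β = -(β + 2 * a) by ring,
    show -(β + a) + β = -a by ring, zero_add]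
  generalize Real.exp (-(β - a) * t) = x
  generalize Real.exp (-(β + a) * t) = y
  generalize Real.exp (-β * t) = z
  have h₁ : β + a ≠ 0 := by positivity
  have h₂ : β + 2 * a ≠ 0 := by positivity
  have h₃ : β + 3 * a ≠ 0 := by positivity
  have h₄ : β - a ≠ 0 := hba.ne'
  field_simp
  ring
end

section
/- Let α, β, μ₀, κ, T > 0, m > 0 with α·m < β, m₂ > 0 and f₀ ∈ ℝ. With Ψ₂ as in the previous statement (Ψ₂(s) = m₂ ( C̃₁ e^{−(β−αm)s} + C̃₂ e^{−2(β+αm)s} + C̃₃ e^{−(β+αm)s} + C̃₄ )), for every t ∈ [0,T]: f₀² + 2 ∫_0^t Ψ₂(s) μ₀ e^{κ(t−s)/T} ds = f₀² + 2 μ₀ m₂ [ (C₁+C₂+C₃+C₄) e^{κ t/T} − C₁ e^{−(β−αm)t} − C₂ e^{−2(β+αm)t} − C₃ e^{−(β+αm)t} − C₄ ], where C₁ = −α²m²/((β−αm)(β+3αm)(β−αm+κ/T)), C₂ = α²m²(β+2αm)/((β+αm)²(β+3αm)(2β+2αm+κ/T)), C₃ = αβm/((β+αm)²(β+αm+κ/T))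 and C₄ = β³/((κ/T)(β+αm)²(β−αm)). -/
open MeasureTheory

/-- The convolution of two exponentials over `[0, t]`. -/
theorem integral_exp_neg_mul_exp_sub (a k t : ℝ) (h : a + k ≠ 0) :
    ∫ s in (0:ℝ)..t, Real.exp (-a * s) * Real.exp (k * (t - s))
      = (Real.exp (k * t) - Real.exp (-a * t)) / (a + k) := by
  have hderiv : ∀ s ∈ Set.uIcc 0 t,
      HasDerivAt (fun s => -(Real.exp (-a * s + k * (t - s)) / (a + k)))
        (Real.exp (-a * s) * Real.exp (k * (t - s))) s := by
    intro s _
    have hlin : HasDerivAt (fun s => -a * s + k * (t - s)) (-a * 1 + k * -1) s :=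
      ((hasDerivAt_id s).const_mul (-a)).add (((hasDerivAt_id s).const_sub t).const_mul k)
    refine (hlin.exp.div_const (a + k)).neg.congr_deriv ?_
    rw [← Real.exp_add]
    field_simp
    ring
  rw [intervalIntegral.integral_eq_sub_of_hasDerivAt hderiv
    ((by fun_prop : Continuous _).intervalIntegrable _ _)]
  simp only [mul_zero, sub_self, sub_zero, add_zero, zero_add]
  ring

/-- Closed form of f₀² + 2∫_0^t Ψ₂(s) μ₀ e^{κ(t−s)/T} ds, giving E(f_t²). -/
theorem second_moment_closed_form
    (α β μ₀ κ T m m₂ f₀ : ℝ) (hα : 0 < α) (hβ : 0 < β) (hμ₀ : 0 < μ₀) (hκ : 0 < κ)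
    (hT : 0 < T) (hm : 0 < m) (hstab : α * m < β) (hm₂ : 0 < m₂) :
    let Ct₁ : ℝ := -(α ^ 2 * m ^ 2) / ((β - α * m) * (β + 3 * α * m))
    let Ct₂ : ℝ := α ^ 2 * m ^ 2 * (β + 2 * α * m)
      / ((β + α * m) ^ 2 * (β + 3 * α * m))
    let Ct₃ : ℝ := α * β * m / (β + α * m) ^ 2
    let Ct₄ : ℝ := β ^ 3 / ((β + α * m) ^ 2 * (β - α * m))
    let Ψ₂ : ℝ → ℝ := fun s =>
      m₂ * (Ct₁ * Real.exp (-(β - α * m) * s) + Ct₂ * Real.exp (-2 * (β + α * m) * s)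
        + Ct₃ * Real.exp (-(β + α * m) * s) + Ct₄)
    let C₁ : ℝ := -(α ^ 2 * m ^ 2)
      / ((β - α * m) * (β + 3 * α * m) * (β - α * m + κ / T))
    let C₂ : ℝ := α ^ 2 * m ^ 2 * (β + 2 * α * m)
      / ((β + α * m) ^ 2 * (β + 3 * α * m) * (2 * β + 2 * α * m + κ / T))
    let C₃ : ℝ := α * β * m / ((β + α * m) ^ 2 * (β + α * m + κ / T))
    let C₄ : ℝ := β ^ 3 / ((κ / T) * (β + α * m) ^ 2 * (β - α * m))
    ∀ t : ℝ, t ∈ Set.Icc (0:ℝ) T →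
      f₀ ^ 2 + 2 * ∫ s in (0:ℝ)..t, Ψ₂ s * (μ₀ * Real.exp (κ * (t - s) / T))
        = f₀ ^ 2 + 2 * μ₀ * m₂ *
            ((C₁ + C₂ + C₃ + C₄) * Real.exp (κ * t / T)
              - C₁ * Real.exp (-(β - α * m) * t)
              - C₂ * Real.exp (-2 * (β + α * m) * t)
              - C₃ * Real.exp (-(β + α * m) * t) - C₄) := by
  intro Ct₁ Ct₂ Ct₃ Ct₄ Ψ₂ C₁ C₂ C₃ C₄ t _
  have hk : 0 < κ / T := div_pos hκ hT
  have hsub : 0 < β - α * m := sub_pos.mpr hstab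
  have hadd : 0 < β + α * m := by positivity
  have hadd3 : 0 < β + 3 * α * m := by positivity
  have hC₁ : C₁ = Ct₁ / (β - α * m + κ / T) := by
    simp only [C₁, Ct₁, div_div]
  have hC₂ : C₂ = Ct₂ / (2 * (β + α * m) + κ / T) := by
    simp only [C₂, Ct₂, div_div]
    ring_nf
  have hC₃ : C₃ = Ct₃ / (β + α * m + κ / T) := by
    simp only [C₃, Ct₃, div_div]
  have hC₄ : C₄ = Ct₄ / (0 + κ / T) := by
    simp only [C₄, Ct₄, div_div]
    ring_nf
  have hint : ∀ a c : ℝ, IntervalIntegrable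
      (fun s => c * (Real.exp (-a * s) * Real.exp (κ / T * (t - s)))) volume 0 t :=
    fun a c => (by fun_prop : Continuous _).intervalIntegrable _ _
  have hsplit : ∀ s, Ψ₂ s * (μ₀ * Real.exp (κ * (t - s) / T)) = μ₀ * m₂ *
      (Ct₁ * (Real.exp (-(β - α * m) * s) * Real.exp (κ / T * (t - s)))
        + Ct₂ * (Real.exp (-(2 * (β + α * m)) * s) * Real.exp (κ / T * (t - s)))
        + Ct₃ * (Real.exp (-(β + α * m) * s) * Real.exp (κ / T * (t - s)))
        + Ct₄ * (Real.exp (-0 * s) * Real.exp (κ / T * (t - s)))) := by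
    intro s
    simp only [Ψ₂, neg_zero, zero_mul, Real.exp_zero, mul_div_right_comm, neg_mul]
    ring
  simp only [hsplit]
  rw [intervalIntegral.integral_const_mul,
    intervalIntegral.integral_add (((hint _ _).add (hint _ _)).add (hint _ _)) (hint _ _),
    intervalIntegral.integral_add ((hint _ _).add (hint _ _)) (hint _ _),
    intervalIntegral.integral_add (hint _ _) (hint _ _)]
  simp only [intervalIntegral.integral_const_mul]
  rw [integral_exp_neg_mul_exp_sub _ _ _ (by positivity),
    integral_exp_neg_mul_exp_sub _ _ _ (by positivity),
    integral_exp_neg_mul_exp_sub _ _ _ (by positivity),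
    integral_exp_neg_mul_exp_sub _ _ _ (by positivity), hC₁, hC₂, hC₃, hC₄]
  simp only [neg_zero, zero_mul, Real.exp_zero, mul_div_right_comm, neg_mul]
  ring
end

section
/- Let α, β, μ₀ > 0, m > 0 with α·m < β, m₂ > 0, and set c = αm/β ∈ (0,1). The stationary signature plot S(δ) = (2 μ₀ m₂/(1−c)) · [ 1/(1+c)² + (1 − 1/(1+c)²) · (1 − e^{−(β+αm)δ})/((β+αm)δ) ] is a strictly decreasing function of δ on (0,∞). -/
theorem strictAntiOn_one_sub_exp_neg_div :
    StrictAntiOn (fun x : ℝ => (1 - Real.exp (-x)) / x) (Set.Ioi 0) := by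
  intro x hx y hy hxy
  have hx' : (0 : ℝ) < x := hx
  have hy' : (0 : ℝ) < y := hy
  have h := strictConvexOn_exp.secant_strict_mono (Set.mem_univ 0) (Set.mem_univ (-y))
    (Set.mem_univ (-x)) (by linarith) (by linarith) (neg_lt_neg hxy)
  have secant_eq (t : ℝ) :
      (Real.exp (-t) - Real.exp 0) / (-t - 0) = (1 - Real.exp (-t)) / t := by
    rw [Real.exp_zero, sub_zero, div_neg, ← neg_div, neg_sub]
  simpa only [secant_eq] using h

/-- The stationary signature plot is strictly decreasing on (0,∞). -/
theorem signature_plot_strict_anti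
    (α β μ₀ m m₂ : ℝ) (hα : 0 < α) (hβ : 0 < β) (hμ₀ : 0 < μ₀) (hm : 0 < m)
    (hstab : α * m < β) (hm₂ : 0 < m₂) :
    let c : ℝ := α * m / β
    let S : ℝ → ℝ := fun δ =>
      (2 * μ₀ * m₂ / (1 - c)) *
        (1 / (1 + c) ^ 2
          + (1 - 1 / (1 + c) ^ 2)
              * ((1 - Real.exp (-(β + α * m) * δ)) / ((β + α * m) * δ)))
    StrictAntiOn S (Set.Ioi 0) := by
  intro c S x hx y hy hxy
  have hx' : (0 : ℝ) < x := hx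
  have hy' : (0 : ℝ) < y := hy
  have hc : 0 < c := by positivity
  have hc1 : 0 < 1 - c := sub_pos.2 ((div_lt_one hβ).2 hstab)
  have hA : 0 < 2 * μ₀ * m₂ / (1 - c) := by positivity
  have hB : 0 < 1 - 1 / (1 + c) ^ 2 := by
    rw [sub_pos, div_lt_one (by positivity)]
    nlinarith
  have hk : 0 < β + α * m := by positivity
  have h := strictAntiOn_one_sub_exp_neg_div (mul_pos hk hx') (mul_pos hk hy')
    (mul_lt_mul_of_pos_left hxy hk)
  simp only [← neg_mul] at h
  exact mul_lt_mul_of_pos_left (add_lt_add_right (mul_lt_mul_of_pos_left h hB) _) hA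
end

section
/- Let Ψ : [0,∞) → ℝ be measurable, nonnegative and integrable, and let μ : [0,1] → ℝ be measurable, nonnegative and bounded. For T > 0 define A_T(v) = ∫_0^{Tv} Ψ(s) · (∫_0^{v − s/T} μ(u) du) ds for v ∈ [0,1] (with the inner integral understood as 0 when v − s/T ≤ 0). Then sup_{v ∈ [0,1]} | A_T(v) − (∫_0^∞ Ψ(s) ds) · (∫_0^v μ(u) du) | → 0 as T → ∞. -/
open MeasureTheory

/-- The primitive of a function bounded by `C` on `[0,1]` has increments at most
`C * min (y - x) 1` up to time `1`. -/
lemma abs_setIntegral_Ioc_sub_le {μ : ℝ → ℝ} {C : ℝ} (hC : 0 ≤ C)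
    (hμ : IntegrableOn μ (Set.Icc 0 1)) (hb : ∀ u ∈ Set.Icc (0:ℝ) 1, ‖μ u‖ ≤ C)
    {x y : ℝ} (hxy : x ≤ y) (hy0 : 0 ≤ y) (hy1 : y ≤ 1) :
    |(∫ u in Set.Ioc (0:ℝ) x, μ u) - ∫ u in Set.Ioc (0:ℝ) y, μ u| ≤ C * min (y - x) 1 := by
  have hy : IntegrableOn μ (Set.Ioc 0 y) :=
    hμ.mono_set fun u hu => ⟨hu.1.le, hu.2.trans hy1⟩
  have hset : Set.Ioc 0 y \ Set.Ioc 0 x = Set.Ioc (max 0 x) y := by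
    ext u
    simp only [Set.mem_sdiff, Set.mem_Ioc, max_lt_iff]
    grind
  rw [abs_sub_comm, ← setIntegral_sdiff measurableSet_Ioc hy (Set.Ioc_subset_Ioc_right hxy), hset,
    ← Real.norm_eq_abs]
  have hmax : max 0 x ≤ y := max_le hy0 hxy
  refine (norm_setIntegral_le_of_norm_le_const measure_Ioc_lt_top fun u hu => hb u
    ⟨(le_max_left 0 x).trans hu.1.le, hu.2.trans hy1⟩).trans ?_
  rw [Real.volume_real_Ioc_of_le hmax]
  refine mul_le_mul_of_nonneg_left (le_min ?_ ?_) hC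
  · linarith [le_max_right 0 x]
  · linarith [le_max_left 0 x]

/-- The truncated first moment of an integrable function vanishes under rescaling. -/
lemma tendsto_setIntegral_mul_min_div {Ψ : ℝ → ℝ} (hΨ : IntegrableOn Ψ (Set.Ioi 0)) (C : ℝ) :
    Filter.Tendsto (fun T : ℝ => ∫ s in Set.Ioi (0:ℝ), Ψ s * (C * min (s / T) 1))
      Filter.atTop (nhds 0) := by
  have h := tendsto_integral_filter_of_dominated_convergence
    (μ := volume.restrict (Set.Ioi (0:ℝ))) (l := Filter.atTop)
    (F := fun (T : ℝ) s => Ψ s * (C * min (s / T) 1)) (f := fun _ => (0:ℝ))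
    (fun s => ‖Ψ s‖ * |C|) ?_ ?_ (hΨ.norm.mul_const _) ?_
  · simpa using h
  · exact Filter.Eventually.of_forall fun T =>
      hΨ.aestronglyMeasurable.mul (by fun_prop)
  · filter_upwards [Filter.eventually_gt_atTop 0] with T hT
    filter_upwards [ae_restrict_mem measurableSet_Ioi] with s hs
    have hs' : 0 ≤ min (s / T) 1 := le_min (div_nonneg (le_of_lt hs) hT.le) zero_le_one
    rw [norm_mul, norm_mul, Real.norm_eq_abs C, Real.norm_of_nonneg hs']
    exact mul_le_mul_of_nonneg_left
      (mul_le_of_le_one_right (abs_nonneg C) (min_le_right _ _)) (norm_nonneg _)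
  · refine Filter.Eventually.of_forall fun s => ?_
    have h1 : Filter.Tendsto (fun T : ℝ => s / T) Filter.atTop (nhds 0) :=
      tendsto_const_nhds.div_atTop Filter.tendsto_id
    simpa using ((h1.min (tendsto_const_nhds (x := (1:ℝ)))).const_mul C).const_mul (Ψ s)

/-- Uniform convergence over v ∈ [0,1] of
A_T(v) = ∫_0^{Tv} Ψ(s)·(∫_0^{v−s/T} μ(u) du) ds to (∫_0^∞ Ψ)·(∫_0^v μ) as T → ∞. -/
theorem uniform_convergence_baseline
    (Ψ : ℝ → ℝ) (hΨ_meas : Measurable Ψ) (hΨ_nonneg : ∀ t : ℝ, 0 ≤ t → 0 ≤ Ψ t)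
    (hΨ_int : IntegrableOn Ψ (Set.Ioi 0))
    (μ : ℝ → ℝ) (hμ_meas : Measurable μ)
    (hμ_nonneg : ∀ u ∈ Set.Icc (0:ℝ) 1, 0 ≤ μ u)
    (hμ_bdd : ∃ C : ℝ, ∀ u ∈ Set.Icc (0:ℝ) 1, μ u ≤ C) :
    ∀ ε > 0, ∃ T₀ : ℝ, ∀ T ≥ T₀, ∀ v ∈ Set.Icc (0:ℝ) 1,
      |(∫ s in Set.Ioc (0:ℝ) (T * v), Ψ s * ∫ u in Set.Ioc (0:ℝ) (v - s / T), μ u)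
        - (∫ s in Set.Ioi (0:ℝ), Ψ s) * ∫ u in Set.Ioc (0:ℝ) v, μ u| < ε := by
  intro ε hε
  obtain ⟨C, hC⟩ := hμ_bdd
  have h0 : (0:ℝ) ∈ Set.Icc (0:ℝ) 1 := by simp
  have hC0 : 0 ≤ C := (hμ_nonneg 0 h0).trans (hC 0 h0)
  have hb : ∀ u ∈ Set.Icc (0:ℝ) 1, ‖μ u‖ ≤ C := fun u hu => by
    rw [Real.norm_of_nonneg (hμ_nonneg u hu)]; exact hC u hu
  have hμ_int : IntegrableOn μ (Set.Icc 0 1) :=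
    Measure.integrableOn_of_bounded (by simp) hμ_meas.aestronglyMeasurable
      (M := C) ((ae_restrict_mem measurableSet_Icc).mono hb)
  obtain ⟨T₀, hT₀⟩ := Filter.eventually_atTop.1
    (((tendsto_setIntegral_mul_min_div hΨ_int C).eventually (gt_mem_nhds hε)).and
      (Filter.eventually_gt_atTop 0))
  refine ⟨T₀, fun T hT v hv => ?_⟩
  obtain ⟨hlt, hTpos⟩ := hT₀ T hT
  refine lt_of_le_of_lt ?_ hlt
  have hincr : ∀ s ∈ Set.Ioi (0:ℝ), |(∫ u in Set.Ioc (0:ℝ) (v - s / T), μ u)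
      - ∫ u in Set.Ioc (0:ℝ) v, μ u| ≤ C * min (s / T) 1 := fun s hs => by
    have hsT : 0 ≤ s / T := div_nonneg (le_of_lt hs) hTpos.le
    simpa using abs_setIntegral_Ioc_sub_le hC0 hμ_int hb (sub_le_self v hsT) hv.1 hv.2
  have hanti : AntitoneOn (fun s => ∫ u in Set.Ioc (0:ℝ) (v - s / T), μ u) (Set.Ioi 0) := by
    intro s hs t _ hst
    have hsT : 0 ≤ s / T := div_nonneg (le_of_lt hs) hTpos.le
    have hst' : s / T ≤ t / T := div_le_div_of_nonneg_right hst hTpos.le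
    have hsub : Set.Ioc 0 (v - s / T) ⊆ Set.Icc (0:ℝ) 1 := fun u hu =>
      ⟨hu.1.le, by linarith [hu.2, hv.2]⟩
    refine setIntegral_mono_set (hμ_int.mono_set hsub) ?_
      (Set.Ioc_subset_Ioc_right (by linarith)).eventuallyLE
    exact (ae_restrict_mem measurableSet_Ioc).mono fun u hu => hμ_nonneg u (hsub hu)
  have hmeas := (aemeasurable_restrict_of_antitoneOn (μ := volume) measurableSet_Ioi
    hanti).aestronglyMeasurable
  have hdiff_int : IntegrableOn (fun s => Ψ s * ((∫ u in Set.Ioc (0:ℝ) (v - s / T), μ u)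
      - ∫ u in Set.Ioc (0:ℝ) v, μ u)) (Set.Ioi 0) := by
    refine Integrable.mul_bdd (c := C) hΨ_int (hmeas.sub aestronglyMeasurable_const) ?_
    filter_upwards [ae_restrict_mem measurableSet_Ioi] with s hs
    exact (hincr s hs).trans (mul_le_of_le_one_right hC0 (min_le_right _ _))
  have hconst_int : IntegrableOn (fun s => Ψ s * ∫ u in Set.Ioc (0:ℝ) v, μ u) (Set.Ioi 0) :=
    hΨ_int.mul_const _
  have hext : ∫ s in Set.Ioc (0:ℝ) (T * v), Ψ s * ∫ u in Set.Ioc (0:ℝ) (v - s / T), μ u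
      = ∫ s in Set.Ioi (0:ℝ), Ψ s * ∫ u in Set.Ioc (0:ℝ) (v - s / T), μ u := by
    refine (setIntegral_eq_of_subset_of_forall_sdiff_eq_zero measurableSet_Ioi
      Set.Ioc_subset_Ioi_self fun s hs => ?_).symm
    have hvs : T * v < s := by
      by_contra! h
      exact hs.2 ⟨hs.1, h⟩
    have : v ≤ s / T := by
      rw [le_div_iff₀ hTpos]; linarith
    rw [Set.Ioc_eq_empty (by linarith)]
    simp
  have hsplit : (∫ s in Set.Ioi (0:ℝ), Ψ s * ∫ u in Set.Ioc (0:ℝ) (v - s / T), μ u)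
      - (∫ s in Set.Ioi (0:ℝ), Ψ s) * ∫ u in Set.Ioc (0:ℝ) v, μ u
      = ∫ s in Set.Ioi (0:ℝ), Ψ s * ((∫ u in Set.Ioc (0:ℝ) (v - s / T), μ u)
        - ∫ u in Set.Ioc (0:ℝ) v, μ u) := by
    rw [← integral_mul_const, sub_eq_iff_eq_add, ← integral_add hdiff_int hconst_int]
    simp only [mul_sub, sub_add_cancel]
  rw [hext, hsplit, ← Real.norm_eq_abs]
  refine norm_integral_le_of_norm_le ?_ ?_
  · refine Integrable.mul_bdd (c := C) hΨ_int (by fun_prop) ?_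
    filter_upwards [ae_restrict_mem measurableSet_Ioi] with s hs
    rw [Real.norm_of_nonneg ((abs_nonneg _).trans (hincr s hs))]
    exact mul_le_of_le_one_right hC0 (min_le_right _ _)
  · filter_upwards [ae_restrict_mem measurableSet_Ioi] with s hs
    rw [norm_mul, Real.norm_of_nonneg (hΨ_nonneg s (le_of_lt hs))]
    exact mul_le_mul_of_nonneg_left (hincr s hs) (hΨ_nonneg s (le_of_lt hs))
end
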